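/- For every non-negative integer n and all integers s, k, m, r, ∑_{j=0}^{n} ∑_{i=0}^{j} (−1)^{i + (s+k+1)j} · C(n,j) · C(j,i) · F_s^{n−j+i} · F_k^{n+j} · F_m^{2n−i} · F_{m−s}^{n−j} · F_{m−k}^{n+j−i} · F_{s−k}^{i} · G_{r + kn + (s−k)j + (m−s)i}² = (F_m · F_k · F_{m−k}² · F_{m−s} · F_{s−k})^n · G_r², where C(n,j) denotes the binomial coefficient. -/

import Mathlib

/-- The sign `(-1)^t` with integer exponent, written with `natAbs`, agrees with `Int.negOnePow`. -/
theorem neg_one_pow_natAbs_eq_negOnePow (t : ℤ) :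
    (-1 : ℤ) ^ t.natAbs = (t.negOnePow : ℤ) := by
  rcases Int.even_or_odd t with h | h
  · rw [(Int.natAbs_even.mpr h).neg_one_pow, Int.negOnePow_even t h, Units.val_one]
  · rw [(Int.natAbs_odd.mpr h).neg_one_pow, Int.negOnePow_odd t h, Units.val_neg, Units.val_one]

theorem negOnePow_val_mul_self (t : ℤ) : (t.negOnePow : ℤ) * t.negOnePow = 1 := by
  rw [← Units.val_mul, Int.units_mul_self, Units.val_one]

/-- A predicate on `ℤ` that is invariant under `a ↦ a + 1` holds everywhere once it holds at `0`. -/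
theorem Int.forall_of_zero_of_iff_succ {P : ℤ → Prop} (h0 : P 0) (h : ∀ a, P a ↔ P (a + 1))
    (a : ℤ) : P a := by
  induction a using Int.induction_on with
  | zero => exact h0
  | succ i ih => exact (h _).1 ih
  | pred i ih => exact (h _).2 (by simpa using ih)

section FibonacciLike

variable {F G : ℤ → ℤ}

theorem fibLike_add_two (hG : ∀ j : ℤ, G j = G (j - 1) + G (j - 2)) (j : ℤ) :
    G (j + 2) = G (j + 1) + G j := by
  rw [hG (j + 2)]
  congr 2 <;> ring

/-- The addition formula for a Fibonacci-like sequence. -/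
theorem fibLike_add (hF0 : F 0 = 0) (hF1 : F 1 = 1)
    (hF : ∀ j : ℤ, F j = F (j - 1) + F (j - 2))
    (hG : ∀ j : ℤ, G j = G (j - 1) + G (j - 2)) (r a : ℤ) :
    G (r + a) = F a * (G (r + 1) - G r) + F (a + 1) * G r := by
  revert r
  refine Int.forall_of_zero_of_iff_succ
    (P := fun a => ∀ r, G (r + a) = F a * (G (r + 1) - G r) + F (a + 1) * G r) ?_ ?_ a
  · simp [hF0, hF1]
  · intro a
    have ha := fibLike_add_two hF a
    constructor
    · intro h r
      have h1 := h (r + 1)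
      have h2 := fibLike_add_two hG r
      rw [show r + (a + 1) = r + 1 + a by ring, h1, show r + 1 + 1 = r + 2 by ring,
        show a + 1 + 1 = a + 2 by ring, h2, ha]
      ring
    · intro h r
      have h1 := h (r - 1)
      have h2 := fibLike_add_two hG (r - 1)
      rw [show r - 1 + (a + 1) = r + a by ring, show r - 1 + 1 = r by ring,
        show a + 1 + 1 = a + 2 by ring, ha] at h1
      rw [show r - 1 + 2 = r + 1 by ring, show r - 1 + 1 = r by ring] at h2
      rw [h1, h2]
      ring

/-- d'Ocagne's identity. -/
theorem fib_sub (hF0 : F 0 = 0) (hF1 : F 1 = 1)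
    (hF : ∀ j : ℤ, F j = F (j - 1) + F (j - 2)) (a b : ℤ) :
    F (a - b) = b.negOnePow * (F a * F (b + 1) - F (a + 1) * F b) := by
  revert a
  refine Int.forall_of_zero_of_iff_succ
    (P := fun b => ∀ a, F (a - b) = b.negOnePow * (F a * F (b + 1) - F (a + 1) * F b)) ?_ ?_ b
  · simp [hF0, hF1]
  · intro b
    have hb := fibLike_add_two hF b
    constructor
    · intro h a
      have h1 := h (a - 1)
      have h2 := fibLike_add_two hF (a - 1)
      rw [show a - 1 + 2 = a + 1 by ring, show a - 1 + 1 = a by ring] at h2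
      rw [show a - (b + 1) = a - 1 - b by ring, h1, show a - 1 + 1 = a by ring,
        show b + 1 + 1 = b + 2 by ring, hb, h2, Int.negOnePow_succ, Units.val_neg]
      ring
    · intro h a
      have h1 := h (a + 1)
      have h2 := fibLike_add_two hF a
      rw [show a + 1 - (b + 1) = a - b by ring, show a + 1 + 1 = a + 2 by ring,
        show b + 1 + 1 = b + 2 by ring, hb, h2, Int.negOnePow_succ, Units.val_neg] at h1
      rw [h1]
      ring

/-- The linear relation between the squares of four terms of a Fibonacci-like sequence. -/
theorem fibLike_sq_relation (hF0 : F 0 = 0) (hF1 : F 1 = 1)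
    (hF : ∀ j : ℤ, F j = F (j - 1) + F (j - 2))
    (hG : ∀ j : ℤ, G j = G (j - 1) + G (j - 2)) (s k m r : ℤ) :
    F s * F m * F (m - s) * G (r + k) ^ 2
        + (s + k + 1).negOnePow * (F k * F m * F (m - k)) * G (r + s) ^ 2
        - (s + k + 1).negOnePow * (F s * F k * F (s - k)) * G (r + m) ^ 2 =
      F (m - k) * F (m - s) * F (s - k) * G r ^ 2 := by
  have hk := negOnePow_val_mul_self k
  rw [fibLike_add hF0 hF1 hF hG r k, fibLike_add hF0 hF1 hF hG r s, fibLike_add hF0 hF1 hF hG r m,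
    fib_sub hF0 hF1 hF m s, fib_sub hF0 hF1 hF m k, fib_sub hF0 hF1 hF s k,
    Int.negOnePow_succ, Int.negOnePow_add, Units.val_neg, Units.val_mul]
  generalize (k.negOnePow : ℤ) = e at *
  generalize (s.negOnePow : ℤ) = d
  generalize F (k + 1) = k', F (s + 1) = s', F (m + 1) = m', F k = k, F s = s, F m = m,
    G (r + 1) = u, G r = v
  linear_combination (d * (s * k * (s * k' - s' * k) * (m * (u - v) + m' * v) ^ 2
    - k * m * (m * k' - m' * k) * (s * (u - v) + s' * v) ^ 2
    - (m * k' - m' * k) * (m * s' - m' * s) * (s * k' - s' * k) * v ^ 2)) * hk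

end FibonacciLike

/-- Iterating a three-term shift relation `A g(r+a) + B g(r+b) + C g(r+c) = D g(r)`. -/
theorem sum_choose_mul_choose_shift {R : Type*} [CommRing R] {g : ℤ → R} {A B C D : R} {a b c : ℤ}
    (h : ∀ r, A * g (r + a) + B * g (r + b) + C * g (r + c) = D * g r) (n : ℕ) (r : ℤ) :
    ∑ j ∈ Finset.range (n + 1), ∑ i ∈ Finset.range (j + 1),
        (n.choose j : R) * (j.choose i : R) * A ^ (n - j) * B ^ (j - i) * C ^ i
          * g (r + a * n + (b - a) * j + (c - b) * i) =
      D ^ n * g r := by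
  let S (t : ℤ) : Module.End R (ℤ → R) := LinearMap.funLeft R R (· + t)
  have hS (t u : ℤ) : Commute (S t) (S u) := by
    refine LinearMap.ext fun f => funext fun x => ?_
    simp [S, LinearMap.funLeft_apply, add_right_comm]
  have hpow (t : ℤ) (p : ℕ) (f : ℤ → R) (x : ℤ) : (S t ^ p) f x = f (x + t * p) := by
    induction p generalizing x with
    | zero => simp
    | succ p ih =>
      rw [pow_succ', Module.End.mul_apply, LinearMap.funLeft_apply, ih]
      congr 1
      push_cast
      ring
  have hcomm (t u : ℤ) (p q : R) : Commute (p • S t) (q • S u) :=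
    ((hS t u).smul_left p).smul_right q
  have hD : (C • S c + B • S b + A • S a) g = D • g := by
    funext x
    simp only [LinearMap.add_apply, LinearMap.smul_apply, Pi.add_apply, Pi.smul_apply, smul_eq_mul,
      S, LinearMap.funLeft_apply, ← h x]
    ring
  have hDn (p : ℕ) : ((C • S c + B • S b + A • S a) ^ p) g = D ^ p • g := by
    induction p with
    | zero => simp
    | succ p ih => rw [pow_succ, Module.End.mul_apply, hD, map_smul, ih, smul_smul, pow_succ']
  have key : _ = D ^ n * g r := congrFun (hDn n) r
  rw [((hcomm c a C A).add_left (hcomm b a B A)).add_pow] at key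
  rw [← key, LinearMap.sum_apply, Finset.sum_apply]
  refine Finset.sum_congr rfl fun j hj => ?_
  rw [(hcomm c b C B).add_pow, Finset.sum_mul, Finset.sum_mul, LinearMap.sum_apply,
    Finset.sum_apply]
  refine Finset.sum_congr rfl fun i hi => ?_
  have hj' : j ≤ n := Finset.mem_range_succ_iff.mp hj
  have hi' : i ≤ j := Finset.mem_range_succ_iff.mp hi
  simp only [smul_pow, Module.End.mul_apply, LinearMap.smul_apply, Pi.smul_apply, smul_eq_mul,
    hpow, Module.End.natCast_apply, nsmul_eq_mul, Pi.mul_apply, Pi.natCast_apply,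
    Nat.cast_sub hj', Nat.cast_sub hi', map_smul]
  rw [show r + c * i + b * ((j : ℤ) - i) + a * ((n : ℤ) - j)
    = r + a * n + (b - a) * j + (c - b) * i by ring]
  ring

/-- Double binomial identity: for every non-negative integer `n` and integers `s,k,m,r`,
`∑_{j=0}^n ∑_{i=0}^j (-1)^{i+(s+k+1)j} C(n,j) C(j,i)
   F_s^{n-j+i} F_k^{n+j} F_m^{2n-i} F_{m-s}^{n-j} F_{m-k}^{n+j-i} F_{s-k}^i
   G_{r+kn+(s-k)j+(m-s)i}²
 = (F_m F_k F_{m-k}² F_{m-s} F_{s-k})^n G_r²`.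
The sign `(-1)^{i+(s+k+1)j}` has an integer exponent; since `(-1)^t` depends only on the
parity of `t`, it is expressed as `(-1)^(t.natAbs)`. -/
theorem stmt_18 (F G : ℤ → ℤ)
    (hF0 : F 0 = 0) (hF1 : F 1 = 1)
    (hF : ∀ j : ℤ, F j = F (j - 1) + F (j - 2))
    (hG : ∀ j : ℤ, G j = G (j - 1) + G (j - 2))
    (n : ℕ) (s k m r : ℤ) :
    ∑ j ∈ Finset.range (n + 1), ∑ i ∈ Finset.range (j + 1),
        (-1 : ℤ) ^ ((i : ℤ) + (s + k + 1) * (j : ℤ)).natAbs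
          * (n.choose j : ℤ) * (j.choose i : ℤ)
          * F s ^ (n - j + i) * F k ^ (n + j) * F m ^ (2 * n - i)
          * F (m - s) ^ (n - j) * F (m - k) ^ (n + j - i) * F (s - k) ^ i
          * G (r + k * (n : ℤ) + (s - k) * (j : ℤ) + (m - s) * (i : ℤ)) ^ 2 =
      (F m * F k * F (m - k) ^ 2 * F (m - s) * F (s - k)) ^ n * G r ^ 2 := by
  set e : ℤ := ((s + k + 1).negOnePow : ℤ) with he
  have key := sum_choose_mul_choose_shift (g := fun t => G t ^ 2)
    (A := F s * F k * F m ^ 2 * F (m - s) * F (m - k))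
    (B := e * F k ^ 2 * F m ^ 2 * F (m - k) ^ 2)
    (C := -e * F s * F k ^ 2 * F m * F (m - k) * F (s - k))
    (D := F m * F k * F (m - k) ^ 2 * F (m - s) * F (s - k)) (a := k) (b := s) (c := m)
    (fun r => by
      linear_combination (F k * F m * F (m - k)) * fibLike_sq_relation hF0 hF1 hF hG s k m r) n r
  rw [← key]
  refine Finset.sum_congr rfl fun j hj => Finset.sum_congr rfl fun i hi => ?_
  obtain ⟨q, rfl⟩ := Nat.exists_eq_add_of_le (Finset.mem_range_succ_iff.mp hi)
  obtain ⟨p, rfl⟩ := Nat.exists_eq_add_of_le (Finset.mem_range_succ_iff.mp hj)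
  have hsign : (-1 : ℤ) ^ ((i : ℤ) + (s + k + 1) * ((i + q : ℕ) : ℤ)).natAbs
      = (-1) ^ i * e ^ (i + q) := by
    rw [neg_one_pow_natAbs_eq_negOnePow, Int.negOnePow_add, Units.val_mul,
      ← neg_one_pow_natAbs_eq_negOnePow i, Int.natAbs_natCast]
    congr 1
    induction i + q with
    | zero => simp
    | succ t ih =>
      rw [Nat.cast_succ, mul_add_one, Int.negOnePow_add, Units.val_mul, ih, pow_succ]
  rw [hsign, show i + q + p - (i + q) = p by omega, show i + q - i = q by omega,
    show 2 * (i + q + p) - i = i + 2 * q + 2 * p by omega,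
    show i + q + p + (i + q) - i = i + 2 * q + p by omega]
  ring
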